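/- Let k ≥ 4. Each of the following two permutations π of {1,…,2k+1} is realized by a second minimal (2k+1)-orbit of some continuous map f : ℝ → ℝ: (a) π agrees with the Stefan permutation π_S except π(1) = 2k+1, π(2) = k+1, π(2k) = 1, π(2k+1) = 2; (b) π agrees with π_S except π(1) = 2k, π(2) = k+1, π(3) = 2k+1, π(2k+1) = 1. -/

import Mathlib

/-- `x` is a periodic point of `f` of (exact) period `n`. -/
def PeriodicPtOfPeriod (f : ℝ → ℝ) (n : ℕ) (x : ℝ) : Prop :=
  f^[n] x = x ∧ ∀ j, 1 ≤ j → j < n → f^[j] x ≠ x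

/-- `β 1 < β 2 < ⋯ < β m` is an `m`-orbit of `f` with permutation `σ`:
each `β t` is a periodic point of period `m`, `σ` permutes `{1,…,m}`,
and `f (β t) = β (σ t)`. -/
def IsOrbitWithPerm (f : ℝ → ℝ) (m : ℕ) (β : ℕ → ℝ) (σ : ℕ → ℕ) : Prop :=
  StrictMonoOn β (Set.Icc 1 m) ∧
  (∀ t ∈ Set.Icc 1 m, PeriodicPtOfPeriod f m (β t)) ∧
  Set.BijOn σ (Set.Icc 1 m) (Set.Icc 1 m) ∧
  (∀ t ∈ Set.Icc 1 m, f (β t) = β (σ t))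

/-- A `(2k+1)`-orbit `β` of `f` is second minimal: `f` has a periodic point of
period `2k−1` with forward orbit in `[β 1, β (2k+1)]`, and no periodic point of
odd period `q` with `1 < q < 2k−1` whose forward orbit lies in `[β 1, β (2k+1)]`. -/
def SecondMinimalOrbit (f : ℝ → ℝ) (k : ℕ) (β : ℕ → ℝ) : Prop :=
  (∃ y, PeriodicPtOfPeriod f (2*k-1) y ∧
      ∀ j : ℕ, f^[j] y ∈ Set.Icc (β 1) (β (2*k+1))) ∧
  ∀ q, Odd q → 1 < q → q < 2*k-1 →
    ¬ ∃ y, PeriodicPtOfPeriod f q y ∧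
        ∀ j : ℕ, f^[j] y ∈ Set.Icc (β 1) (β (2*k+1))

/-- The Stefan permutation of `{1,…,2k+1}`. -/
def stefanPerm (k : ℕ) (t : ℕ) : ℕ :=
  if t = 1 then k+1 else if t ≤ k+1 then 2*k+3-t else 2*k+2-t

/-- The permutation `π` of `{1,…,2k+1}` is realized by a second minimal
`(2k+1)`-orbit of some continuous map. -/
def RealizedSM (k : ℕ) (π : ℕ → ℕ) : Prop :=
  ∃ f : ℝ → ℝ, ∃ β : ℕ → ℝ, Continuous f ∧
    IsOrbitWithPerm f (2*k+1) β π ∧ SecondMinimalOrbit f k β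

open Function Set

/-- A piecewise linear map with vertices at `1, 2, 3, 4, K+1, K+2, 2K-1, 2K, 2K+1`. For `e = 0` and
`e = 1` it joins the dots of the two second minimal permutations. -/
noncomputable def dotsMap (K e x : ℝ) : ℝ :=
  if x ≤ 2 then K + 1 + (K - e) * (2 - x)
  else if x ≤ 3 then K + 1 + (K - 1 + e) * (x - 2)
  else if x ≤ 4 then 2 * K - 1 + (1 + e) * (4 - x)
  else if x ≤ K + 1 then 2 * K + 3 - x
  else if x ≤ K + 2 then 3 * K + 4 - 2 * x
  else if x ≤ 2 * K - 1 then 2 * K + 2 - x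
  else if x ≤ 2 * K then 3 - (2 - e) * (x - (2 * K - 1))
  else 1 + e + (1 - 2 * e) * (x - 2 * K)

theorem periodicPtOfPeriod_iff_minimalPeriod {f : ℝ → ℝ} {n : ℕ} (hn : 0 < n) {x : ℝ} :
    PeriodicPtOfPeriod f n x ↔ minimalPeriod f x = n := by
  constructor
  · rintro ⟨hx, hlt⟩
    have hp : IsPeriodicPt f n x := hx
    refine le_antisymm (hp.minimalPeriod_le hn) ?_
    by_contra! h
    exact hlt _ (hp.minimalPeriod_pos hn) h iterate_minimalPeriod
  · rintro rfl
    exact ⟨iterate_minimalPeriod, fun j hj hlt h =>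
      not_isPeriodicPt_of_pos_of_lt_minimalPeriod (by omega) hlt h⟩

section DotsMap

variable {K e : ℝ}

theorem continuous_dotsMap (hK : 4 ≤ K) : Continuous (dotsMap K e) := by
  unfold dotsMap
  refine Continuous.if_le (by fun_prop) ?_ continuous_id continuous_const ?_
  · refine Continuous.if_le (by fun_prop) ?_ continuous_id continuous_const ?_
    · refine Continuous.if_le (by fun_prop) ?_ continuous_id continuous_const ?_
      · refine Continuous.if_le (by fun_prop) ?_ continuous_id continuous_const ?_
        · refine Continuous.if_le (by fun_prop) ?_ continuous_id continuous_const ?_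
          · refine Continuous.if_le (by fun_prop) ?_ continuous_id continuous_const ?_
            · refine Continuous.if_le (by fun_prop) (by fun_prop) continuous_id
                continuous_const ?_
              rintro x rfl
              ring
            · rintro x rfl
              rw [if_pos (by linarith)]
              ring
          · rintro x rfl
            rw [if_pos (by linarith)]
            ring
        · rintro x rfl
          rw [if_pos (by linarith)]
          ring
      · rintro x rfl
        rw [if_pos (by linarith)]
        ring
    · rintro x rfl
      rw [if_pos (by linarith)]
      ring
  · rintro x rfl
    rw [if_pos (by linarith)]
    ring

theorem dotsMap_of_le_two {x : ℝ} (hx : x ≤ 2) :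
    dotsMap K e x = K + 1 + (K - e) * (2 - x) := if_pos hx

theorem dotsMap_of_mem_Icc_two_three {x : ℝ} (hx : x ∈ Icc 2 3) :
    dotsMap K e x = K + 1 + (K - 1 + e) * (x - 2) := by
  obtain ⟨h₁, h₂⟩ := hx
  rcases h₁.eq_or_lt with rfl | h₁
  · rw [dotsMap_of_le_two le_rfl]; ring
  · rw [dotsMap, if_neg (by linarith), if_pos h₂]

theorem dotsMap_of_mem_Icc_three_four {x : ℝ} (hx : x ∈ Icc 3 4) :
    dotsMap K e x = 2 * K - 1 + (1 + e) * (4 - x) := by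
  obtain ⟨h₁, h₂⟩ := hx
  rcases h₁.eq_or_lt with rfl | h₁
  · rw [dotsMap_of_mem_Icc_two_three (by norm_num)]; ring
  · rw [dotsMap, if_neg (by linarith), if_neg (by linarith), if_pos h₂]

theorem dotsMap_of_mem_Icc_four {x : ℝ} (hx : x ∈ Icc 4 (K + 1)) :
    dotsMap K e x = 2 * K + 3 - x := by
  obtain ⟨h₁, h₂⟩ := hx
  rcases h₁.eq_or_lt with rfl | h₁
  · rw [dotsMap_of_mem_Icc_three_four (by norm_num)]; ring
  · rw [dotsMap, if_neg (by linarith), if_neg (by linarith), if_neg (by linarith), if_pos h₂]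

theorem dotsMap_of_mem_Icc_mid (hK : 4 ≤ K) {x : ℝ} (hx : x ∈ Icc (K + 1) (K + 2)) :
    dotsMap K e x = 3 * K + 4 - 2 * x := by
  obtain ⟨h₁, h₂⟩ := hx
  rcases h₁.eq_or_lt with rfl | h₁
  · rw [dotsMap_of_mem_Icc_four ⟨by linarith, le_rfl⟩]; ring
  · rw [dotsMap, if_neg (by linarith), if_neg (by linarith), if_neg (by linarith),
      if_neg (by linarith), if_pos h₂]

theorem dotsMap_of_mem_Icc_right (hK : 4 ≤ K) {x : ℝ} (hx : x ∈ Icc (K + 2) (2 * K - 1)) :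
    dotsMap K e x = 2 * K + 2 - x := by
  obtain ⟨h₁, h₂⟩ := hx
  rcases h₁.eq_or_lt with rfl | h₁
  · rw [dotsMap_of_mem_Icc_mid hK ⟨by linarith, le_rfl⟩]; ring
  · rw [dotsMap, if_neg (by linarith), if_neg (by linarith), if_neg (by linarith),
      if_neg (by linarith), if_neg (by linarith), if_pos h₂]

theorem dotsMap_of_mem_Icc_pred (hK : 4 ≤ K) {x : ℝ} (hx : x ∈ Icc (2 * K - 1) (2 * K)) :
    dotsMap K e x = 3 - (2 - e) * (x - (2 * K - 1)) := by
  obtain ⟨h₁, h₂⟩ := hx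
  rcases h₁.eq_or_lt with rfl | h₁
  · rw [dotsMap_of_mem_Icc_right hK ⟨by linarith, le_rfl⟩]; ring
  · rw [dotsMap, if_neg (by linarith), if_neg (by linarith), if_neg (by linarith),
      if_neg (by linarith), if_neg (by linarith), if_neg (by linarith), if_pos h₂]

theorem dotsMap_of_two_mul_le (hK : 4 ≤ K) {x : ℝ} (hx : 2 * K ≤ x) :
    dotsMap K e x = 1 + e + (1 - 2 * e) * (x - 2 * K) := by
  rcases hx.eq_or_lt with rfl | h₁
  · rw [dotsMap_of_mem_Icc_pred hK ⟨by linarith, le_rfl⟩]; ring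
  · rw [dotsMap, if_neg (by linarith), if_neg (by linarith), if_neg (by linarith),
      if_neg (by linarith), if_neg (by linarith), if_neg (by linarith), if_neg (by linarith)]

theorem dotsMap_mem_of_le_three (hK : 4 ≤ K) (he : e ∈ Icc 0 1) {x : ℝ} (hx : x ∈ Icc 1 3) :
    dotsMap K e x ∈ Icc (K + 1) (2 * K + 1) := by
  obtain ⟨he₀, he₁⟩ := he
  obtain ⟨h₁, h₃⟩ := hx
  rcases le_total x 2 with h | h
  · rw [dotsMap_of_le_two h]
    constructor <;> nlinarith
  · rw [dotsMap_of_mem_Icc_two_three ⟨h, h₃⟩]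
    constructor <;> nlinarith

theorem dotsMap_mem_of_mem_Icc_three_four (he : e ∈ Icc 0 1) {x : ℝ} (hx : x ∈ Icc 3 4) :
    dotsMap K e x ∈ Icc (2 * K - 1) (2 * K + 1) := by
  obtain ⟨he₀, he₁⟩ := he
  obtain ⟨h₁, h₂⟩ := hx
  rw [dotsMap_of_mem_Icc_three_four ⟨h₁, h₂⟩]
  constructor <;> nlinarith

theorem dotsMap_mem_of_pred_le (hK : 4 ≤ K) (he : e ∈ Icc 0 1) {x : ℝ}
    (hx : x ∈ Icc (2 * K - 1) (2 * K + 1)) : dotsMap K e x ∈ Icc 1 3 := by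
  obtain ⟨he₀, he₁⟩ := he
  obtain ⟨h₁, h₂⟩ := hx
  rcases le_total x (2 * K) with h | h
  · rw [dotsMap_of_mem_Icc_pred hK ⟨h₁, h⟩]
    constructor <;> nlinarith
  · rw [dotsMap_of_two_mul_le hK h]
    constructor <;> nlinarith

theorem dotsMap_mem_of_le_mid (hK : 4 ≤ K) (he : e ∈ Icc 0 1) {x : ℝ}
    (hx : x ∈ Icc 1 (K + 1)) : dotsMap K e x ∈ Icc (K + 1) (2 * K + 1) := by
  obtain ⟨h₁, h₂⟩ := hx
  rcases le_total x 3 with h | h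
  · exact dotsMap_mem_of_le_three hK he ⟨h₁, h⟩
  rcases le_total x 4 with h' | h'
  · have := dotsMap_mem_of_mem_Icc_three_four (K := K) he ⟨h, h'⟩
    exact ⟨by linarith [this.1], this.2⟩
  · rw [dotsMap_of_mem_Icc_four ⟨h', h₂⟩]
    constructor <;> linarith

theorem dotsMap_mem_of_mid_le (hK : 4 ≤ K) (he : e ∈ Icc 0 1) {x : ℝ}
    (hx : x ∈ Icc (K + 2) (2 * K + 1)) : dotsMap K e x ∈ Icc 1 K := by
  obtain ⟨h₁, h₂⟩ := hx
  rcases le_total x (2 * K - 1) with h | h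
  · rw [dotsMap_of_mem_Icc_right hK ⟨h₁, h⟩]
    constructor <;> linarith
  · have := dotsMap_mem_of_pred_le hK he ⟨h, h₂⟩
    exact ⟨this.1, by linarith [this.2]⟩

theorem mapsTo_dotsMap (hK : 4 ≤ K) (he : e ∈ Icc 0 1) :
    MapsTo (dotsMap K e) (Icc 1 (2 * K + 1)) (Icc 1 (2 * K + 1)) := by
  rintro x ⟨h₁, h₂⟩
  rcases le_total x (K + 1) with h | h
  · have := dotsMap_mem_of_le_mid hK he ⟨h₁, h⟩
    exact ⟨by linarith [this.1], this.2⟩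
  rcases le_total x (K + 2) with h' | h'
  · rw [dotsMap_of_mem_Icc_mid hK ⟨h, h'⟩]
    constructor <;> linarith
  · have := dotsMap_mem_of_mid_le hK he ⟨h', h₂⟩
    exact ⟨this.1, by linarith [this.2]⟩

/-- On `[4, K+1]` the second iterate is the translation by `-1`. -/
theorem dotsMap_iterate_even (hK : 4 ≤ K) {y : ℝ} (hy : y ≤ K + 1) (i : ℕ) (hi : i + 3 ≤ y) :
    (dotsMap K e)^[2 * i] y = y - i := by
  induction i with
  | zero => simp
  | succ i ih =>
    push_cast at hi ⊢
    have hi₀ : (0 : ℝ) ≤ i := i.cast_nonneg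
    rw [show 2 * (i + 1) = (2 * i) + 1 + 1 by ring, iterate_succ_apply', iterate_succ_apply',
      ih (by linarith), dotsMap_of_mem_Icc_four (x := y - i) ⟨by linarith, by linarith⟩,
      dotsMap_of_mem_Icc_right hK ⟨by linarith, by linarith⟩]
    ring

theorem dotsMap_iterate_odd (hK : 4 ≤ K) {y : ℝ} (hy : y ≤ K + 1) (i : ℕ) (hi : i + 4 ≤ y) :
    (dotsMap K e)^[2 * i + 1] y = 2 * K + 3 - y + i := by
  have hi₀ : (0 : ℝ) ≤ i := i.cast_nonneg
  rw [iterate_succ_apply', dotsMap_iterate_even hK hy i (by linarith),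
    dotsMap_of_mem_Icc_four ⟨by linarith, by linarith⟩]
  ring

end DotsMap

section Dynamics

variable {k : ℕ} {e : ℝ}

/-- A point of `[k, k+1)` needs more than `2k-4` steps to enter `[k+1, k+2]`. -/
theorem dotsMap_iterate_notMem_mid (hk : 4 ≤ k) (he : e ∈ Icc 0 1) {z : ℝ}
    (hz : z ∈ Ico (k : ℝ) (k + 1)) {n : ℕ} (hn : n ≤ 2 * k - 4) :
    (dotsMap k e)^[n] z ∉ Icc (k + 1 : ℝ) (k + 2) := by
  have hK : (4 : ℝ) ≤ k := by exact_mod_cast hk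
  obtain ⟨hz₁, hz₂⟩ := hz
  have key : (dotsMap k e)^[2 * (k - 3)] z ∈ Icc 3 4 := by
    have hc : ((k - 3 : ℕ) : ℝ) = k - 3 := by push_cast [show 3 ≤ k by omega]; ring
    rw [dotsMap_iterate_even hK hz₂.le _ (by rw [hc]; linarith), hc]
    constructor <;> linarith
  have key₁ := dotsMap_mem_of_mem_Icc_three_four (K := k) he key
  have key₂ := dotsMap_mem_of_pred_le hK he key₁
  rw [← iterate_succ_apply' (dotsMap k e)] at key₁ key₂
  rw [← iterate_succ_apply' (dotsMap k e)] at key₂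
  rintro ⟨h₁, h₂⟩
  rcases (by omega : n = 2 * (k - 3) + 1 + 1 ∨ n = 2 * (k - 3) + 1 ∨ n ≤ 2 * (k - 3)) with
    rfl | rfl | hn'
  · linarith [key₂.2]
  · linarith [key₁.1]
  · obtain ⟨i, rfl | rfl⟩ := n.even_or_odd'
    · have hi : (i : ℝ) + 3 ≤ k := by exact_mod_cast (by omega : i + 3 ≤ k)
      rw [dotsMap_iterate_even hK hz₂.le i (by linarith)] at h₁
      linarith [i.cast_nonneg (α := ℝ)]
    · have hi : (i : ℝ) + 4 ≤ k := by exact_mod_cast (by omega : i + 4 ≤ k)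
      rw [dotsMap_iterate_odd hK hz₂.le i (by linarith)] at h₂
      linarith [i.cast_nonneg (α := ℝ)]

/-- An orbit of odd period meets `[k+1, k+2]`. -/
theorem exists_iterate_mem_mid (hk : 4 ≤ k) (he : e ∈ Icc 0 1) {q : ℕ} (hq : Odd q) {y : ℝ}
    (hy : (dotsMap k e)^[q] y = y)
    (hmem : ∀ j, (dotsMap k e)^[j] y ∈ Icc (1 : ℝ) (2 * k + 1)) :
    ∃ j, (dotsMap k e)^[j] y ∈ Icc (k + 1 : ℝ) (k + 2) := by
  have hK : (4 : ℝ) ≤ k := by exact_mod_cast hk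
  by_contra! hno
  have hL : ∀ j, (dotsMap k e)^[j] y < k + 1 → k + 2 < (dotsMap k e)^[j + 1] y := by
    intro j hj
    have h := (dotsMap_mem_of_le_mid hK he ⟨(hmem j).1, hj.le⟩).1
    rw [← iterate_succ_apply' (dotsMap k e)] at h
    by_contra! h'
    exact hno _ ⟨h, h'⟩
  have hR : ∀ j, k + 2 < (dotsMap k e)^[j] y → (dotsMap k e)^[j + 1] y < k + 1 := by
    intro j hj
    have h := (dotsMap_mem_of_mid_le hK he ⟨hj.le, (hmem j).2⟩).2
    rw [← iterate_succ_apply' (dotsMap k e)] at h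
    linarith
  obtain ⟨m, rfl⟩ := hq
  rcases lt_or_ge y (k + 1) with h | h
  · have hev : ∀ i, (dotsMap k e)^[2 * i] y < k + 1 := by
      intro i
      induction i with
      | zero => exact h
      | succ i ih => exact hR _ (hL _ ih)
    have := hL _ (hev m)
    rw [hy] at this
    linarith
  · have h' : k + 2 < y := by
      by_contra! h'
      exact hno 0 ⟨h, h'⟩
    have hev : ∀ i, k + 2 < (dotsMap k e)^[2 * i] y := by
      intro i
      induction i with
      | zero => exact h'
      | succ i ih => exact hL _ (hR _ ih)
    have := hR _ (hev m)
    rw [hy] at this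
    linarith

/-- The middle piece is expanding, so a periodic point in `[k+1, k+2]` that is not fixed leaves
`[k+1, k+2]`, and it does so through `[k, k+1)`. -/
theorem exists_iterate_leaves_mid (hk : 4 ≤ k) {q : ℕ} (hq : 0 < q) {y : ℝ}
    (hy : (dotsMap k e)^[q] y = y) (hfix : dotsMap k e y ≠ y)
    (hmid : y ∈ Icc (k + 1 : ℝ) (k + 2)) :
    ∃ j, (dotsMap k e)^[j] y ∈ Icc (k + 1 : ℝ) (k + 2) ∧
      (dotsMap k e)^[j + 1] y ∈ Ico (k : ℝ) (k + 1) := by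
  have hK : (4 : ℝ) ≤ k := by exact_mod_cast hk
  by_contra! hno
  have hstay : ∀ j, (dotsMap k e)^[j] y ∈ Icc (k + 1 : ℝ) (k + 2) ∧
      (dotsMap k e)^[j] y - (k + 4 / 3) = (-2) ^ j * (y - (k + 4 / 3)) := by
    intro j
    induction j with
    | zero => exact ⟨hmid, by simp⟩
    | succ j ih =>
      obtain ⟨hm, hj⟩ := ih
      have hn := hno j hm
      rw [iterate_succ_apply', dotsMap_of_mem_Icc_mid hK hm] at hn ⊢
      refine ⟨⟨?_, by linarith [hm.1]⟩, ?_⟩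
      · by_contra! h
        exact hn ⟨by linarith [hm.2], h⟩
      · rw [pow_succ]
        linarith
  have h := (hstay q).2
  rw [hy] at h
  have hpow : ((-2 : ℝ)) ^ q ≠ 1 := by
    intro h1
    have h2 : |(-2 : ℝ) ^ q| = 1 := by rw [h1, abs_one]
    rw [abs_pow, abs_neg, abs_two] at h2
    exact (one_lt_pow₀ one_lt_two hq.ne').ne' h2
  have hy0 : y - (k + 4 / 3) = 0 := by
    by_contra h0
    exact hpow (mul_right_cancel₀ h0 (by rw [one_mul]; exact h.symm))
  apply hfix
  rw [dotsMap_of_mem_Icc_mid hK hmid]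
  linarith

theorem not_exists_periodicPt_dotsMap (hk : 4 ≤ k) (he : e ∈ Icc 0 1) {q : ℕ} (hq : Odd q)
    (hq₁ : 1 < q) (hqk : q < 2 * k - 1) :
    ¬ ∃ y, PeriodicPtOfPeriod (dotsMap k e) q y ∧
      ∀ j : ℕ, (dotsMap k e)^[j] y ∈ Icc (1 : ℝ) (2 * k + 1) := by
  rintro ⟨y, hy, hmem⟩
  have hper : ∀ j, PeriodicPtOfPeriod (dotsMap k e) q ((dotsMap k e)^[j] y) := by
    intro j
    rw [periodicPtOfPeriod_iff_minimalPeriod (by omega)] at hy ⊢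
    have hyp : y ∈ periodicPts (dotsMap k e) := by
      rw [← minimalPeriod_pos_iff_mem_periodicPts]
      omega
    rw [minimalPeriod_apply_iterate hyp, hy]
  obtain ⟨i, hi⟩ := exists_iterate_mem_mid hk he hq hy.1 hmem
  obtain ⟨j, hj, hj'⟩ := exists_iterate_leaves_mid hk (by omega) (hper i).1
    ((hper i).2 1 le_rfl hq₁) hi
  refine dotsMap_iterate_notMem_mid hk he hj' (n := q - 1) (by obtain ⟨m, rfl⟩ := hq; omega) ?_
  rw [← iterate_add_apply, show q - 1 + (j + 1) = q + j by omega, iterate_add_apply,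
    ← iterate_add_apply _ j, (hper (j + i)).1, iterate_add_apply]
  exact hj

theorem exists_periodicPt_dotsMap (hk : 4 ≤ k) (he : e = 0 ∨ e = 1) :
    ∃ y, PeriodicPtOfPeriod (dotsMap k e) (2 * k - 1) y ∧
      ∀ j : ℕ, (dotsMap k e)^[j] y ∈ Icc (1 : ℝ) (2 * k + 1) := by
  have hK : (4 : ℝ) ≤ k := by exact_mod_cast hk
  have heI : e ∈ Icc (0 : ℝ) 1 := by rcases he with rfl | rfl <;> simp
  have hee : (2 - e) * (1 + e) = 2 := by rcases he with rfl | rfl <;> norm_num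
  set c : ℝ := k - 1 + e with hc
  have hc3 : 3 ≤ c := by linarith [heI.1]
  set u : ℝ := c / (8 * c - 1) with hu
  have hu' : u * (8 * c - 1) = c := div_mul_cancel₀ _ (by linarith)
  have hu₁ : 1 / 8 < u := by rw [hu, lt_div_iff₀ (by linarith)]; linarith
  have hu₂ : u < 1 / 6 := by rw [hu, div_lt_iff₀ (by linarith)]; linarith
  set z : ℝ := k + 4 * u with hz
  have hcast : ((k - 3 : ℕ) : ℝ) = k - 3 := by push_cast [show 3 ≤ k by omega]; ring
  have h₀ : (dotsMap k e)^[2 * (k - 3)] z = 3 + 4 * u := by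
    rw [dotsMap_iterate_even hK (by linarith) _ (by rw [hcast]; linarith), hcast]
    ring
  have h₁ : (dotsMap k e)^[2 * (k - 3) + 1] z = 2 * k - 1 + (1 + e) * (1 - 4 * u) := by
    rw [iterate_succ_apply', h₀, dotsMap_of_mem_Icc_three_four ⟨by linarith, by linarith⟩]
    ring
  have hpos : 0 ≤ (1 + e) * (1 - 4 * u) :=
    mul_nonneg (by linarith [heI.1]) (by linarith)
  have h₂ : (dotsMap k e)^[2 * (k - 3) + 2] z = 1 + 8 * u := by
    rw [iterate_succ_apply', h₁, dotsMap_of_mem_Icc_pred hK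
      ⟨by linarith, by nlinarith [heI.2]⟩]
    linear_combination (-(1 - 4 * u)) * hee
  have h₃ : (dotsMap k e)^[2 * (k - 3) + 3] z = k + 1 + u := by
    rw [iterate_succ_apply', h₂, dotsMap_of_mem_Icc_two_three ⟨by linarith, by linarith⟩, ← hc]
    linear_combination hu'
  have h₄ : (dotsMap k e)^[2 * (k - 3) + 4] z = k + 2 - 2 * u := by
    rw [iterate_succ_apply', h₃, dotsMap_of_mem_Icc_mid hK ⟨by linarith, by linarith⟩]
    ring
  have h₅ : (dotsMap k e)^[2 * (k - 3) + 5] z = z := by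
    rw [iterate_succ_apply', h₄, dotsMap_of_mem_Icc_mid hK ⟨by linarith, by linarith⟩]
    ring
  refine ⟨z, ⟨?_, ?_⟩, fun j => ?_⟩
  · rwa [show 2 * k - 1 = 2 * (k - 3) + 5 by omega]
  · intro j hj₁ hj₂
    rcases (by omega : j = 2 * (k - 3) + 4 ∨ j = 2 * (k - 3) + 3 ∨ j = 2 * (k - 3) + 2 ∨
      j = 2 * (k - 3) + 1 ∨ j ≤ 2 * (k - 3)) with rfl | rfl | rfl | rfl | hj
    · rw [h₄]; exact ne_of_gt (by linarith)
    · rw [h₃]; exact ne_of_gt (by linarith)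
    · rw [h₂]; exact ne_of_lt (by linarith)
    · rw [h₁]; exact ne_of_gt (by linarith)
    · obtain ⟨i, rfl | rfl⟩ := j.even_or_odd'
      · have hi : (i : ℝ) + 3 ≤ k := by exact_mod_cast (by omega : i + 3 ≤ k)
        have hi₀ : (1 : ℝ) ≤ i := by exact_mod_cast (by omega : 1 ≤ i)
        rw [dotsMap_iterate_even hK (by linarith) i (by linarith)]
        exact ne_of_lt (by linarith)
      · have hi : (i : ℝ) + 4 ≤ k := by exact_mod_cast (by omega : i + 4 ≤ k)
        rw [dotsMap_iterate_odd hK (by linarith) i (by linarith)]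
        exact ne_of_gt (by linarith [i.cast_nonneg (α := ℝ)])
  · exact (mapsTo_dotsMap hK heI).iterate j ⟨by linarith, by linarith⟩

theorem periodicPtOfPeriod_dotsMap (hk : 4 ≤ k) (he : e = 0 ∨ e = 1) {t : ℕ}
    (ht : t ∈ Icc 1 (2 * k + 1)) : PeriodicPtOfPeriod (dotsMap k e) (2 * k + 1) t := by
  have hK : (4 : ℝ) ≤ k := by exact_mod_cast hk
  have hcast : ((k - 2 : ℕ) : ℝ) = k - 2 := by push_cast [show 2 ≤ k by omega]; ring
  have h₀ : dotsMap k e 2 = k + 1 := by rw [dotsMap_of_le_two le_rfl]; ring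
  have hodd : ∀ i : ℕ, i + 2 ≤ k → (dotsMap k e)^[2 * i + 1] 2 = k + 1 - i := by
    intro i hi
    have : (i : ℝ) + 2 ≤ k := by exact_mod_cast hi
    rw [iterate_succ_apply, h₀, dotsMap_iterate_even hK le_rfl i (by linarith)]
  have heven : ∀ i : ℕ, i + 3 ≤ k → (dotsMap k e)^[2 * i + 2] 2 = k + 2 + i := by
    intro i hi
    have : (i : ℝ) + 3 ≤ k := by exact_mod_cast hi
    rw [iterate_succ_apply, h₀, dotsMap_iterate_odd hK le_rfl i (by linarith)]
    ring
  have h₁ : (dotsMap k e)^[2 * (k - 2) + 1] 2 = 3 := by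
    rw [hodd _ (by omega), hcast]; ring
  have h₂ : (dotsMap k e)^[2 * (k - 2) + 2] 2 = 2 * k + e := by
    rw [iterate_succ_apply', h₁, dotsMap_of_mem_Icc_three_four (by norm_num)]; ring
  have h₃ : (dotsMap k e)^[2 * (k - 2) + 3] 2 = 1 := by
    rw [iterate_succ_apply', h₂, dotsMap_of_two_mul_le hK (by rcases he with rfl | rfl <;> simp)]
    rcases he with rfl | rfl <;> ring
  have h₄ : (dotsMap k e)^[2 * (k - 2) + 4] 2 = 2 * k + 1 - e := by
    rw [iterate_succ_apply', h₃, dotsMap_of_le_two (by norm_num)]; ring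
  have h₅ : (dotsMap k e)^[2 * (k - 2) + 5] 2 = 2 := by
    rw [iterate_succ_apply', h₄,
      dotsMap_of_two_mul_le hK (by rcases he with rfl | rfl <;> norm_num)]
    rcases he with rfl | rfl <;> ring
  have hper : PeriodicPtOfPeriod (dotsMap k e) (2 * k + 1) 2 := by
    refine ⟨by rwa [show 2 * k + 1 = 2 * (k - 2) + 5 by omega], fun j hj₁ hj₂ => ?_⟩
    have he₁ : 0 ≤ e ∧ e ≤ 1 := by rcases he with rfl | rfl <;> simp
    rcases (by omega : j = 2 * (k - 2) + 4 ∨ j = 2 * (k - 2) + 3 ∨ j = 2 * (k - 2) + 2 ∨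
      j < 2 * (k - 2) + 2) with rfl | rfl | rfl | hj
    · rw [h₄]; exact ne_of_gt (by linarith)
    · rw [h₃]; norm_num
    · rw [h₂]; exact ne_of_gt (by linarith)
    · obtain ⟨i, rfl | rfl⟩ := j.even_or_odd'
      · obtain ⟨i, rfl⟩ := Nat.exists_eq_succ_of_ne_zero (by omega : i ≠ 0)
        rw [show 2 * i.succ = 2 * i + 2 by omega, heven i (by omega)]
        exact ne_of_gt (by linarith [i.cast_nonneg (α := ℝ)])
      · have : (i : ℝ) + 2 ≤ k := by exact_mod_cast (by omega : i + 2 ≤ k)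
        rw [hodd i (by omega)]
        exact ne_of_gt (by linarith)
  obtain ⟨j, hj⟩ : ∃ j, (dotsMap k e)^[j] 2 = t := by
    obtain ⟨ht₁, ht₂⟩ := ht
    rcases (by omega : t = 1 ∨ t = 2 ∨ (3 ≤ t ∧ t ≤ k + 1) ∨ (k + 2 ≤ t ∧ t ≤ 2 * k - 1) ∨
      t = 2 * k ∨ t = 2 * k + 1) with rfl | rfl | ⟨h, h'⟩ | ⟨h, h'⟩ | rfl | rfl
    · exact ⟨_, by rw [h₃]; norm_num⟩
    · exact ⟨0, by norm_num⟩
    · exact ⟨_, by rw [hodd (k + 1 - t) (by omega)]; push_cast [h']; ring⟩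
    · exact ⟨_, by rw [heven (t - (k + 2)) (by omega)]; push_cast [h]; ring⟩
    · rcases he with rfl | rfl
      · exact ⟨_, by rw [h₂]; push_cast; ring⟩
      · exact ⟨_, by rw [h₄]; push_cast; ring⟩
    · rcases he with rfl | rfl
      · exact ⟨_, by rw [h₄]; push_cast; ring⟩
      · exact ⟨_, by rw [h₂]; push_cast; ring⟩
  rw [periodicPtOfPeriod_iff_minimalPeriod (by omega)] at hper ⊢
  have hp : (2 : ℝ) ∈ periodicPts (dotsMap k e) := by
    rw [← minimalPeriod_pos_iff_mem_periodicPts]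
    omega
  rw [← hj, minimalPeriod_apply_iterate hp, hper]

theorem realizedSM_of_dotsMap (hk : 4 ≤ k) (he : e = 0 ∨ e = 1) {π : ℕ → ℕ}
    (hmaps : MapsTo π (Icc 1 (2 * k + 1)) (Icc 1 (2 * k + 1)))
    (hinj : InjOn π (Icc 1 (2 * k + 1)))
    (hπ : ∀ t ∈ Icc 1 (2 * k + 1), dotsMap k e t = π t) : RealizedSM k π := by
  have hK : (4 : ℝ) ≤ k := by exact_mod_cast hk
  have heI : e ∈ Icc (0 : ℝ) 1 := by rcases he with rfl | rfl <;> simp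
  refine ⟨dotsMap k e, fun t => t, continuous_dotsMap hK,
    ⟨Nat.strictMono_cast.strictMonoOn _, fun t ht => periodicPtOfPeriod_dotsMap hk he ht,
      ((finite_Icc _ _).injOn_iff_bijOn_of_mapsTo hmaps).1 hinj, hπ⟩, ?_⟩
  unfold SecondMinimalOrbit
  push_cast
  exact ⟨exists_periodicPt_dotsMap hk he, fun q hq hq₁ hqk =>
    not_exists_periodicPt_dotsMap hk heI hq hq₁ hqk⟩

/-- The values of the map at the integers `4 ≤ t ≤ 2k-1` are those of the Stefan permutation. -/
theorem dotsMap_natCast_eq_stefanPerm (hk : 4 ≤ k) {t : ℕ} (h₁ : 4 ≤ t) (h₂ : t ≤ 2 * k - 1) :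
    dotsMap k e t = stefanPerm k t := by
  have hK : (4 : ℝ) ≤ k := by exact_mod_cast hk
  have ht₁ : (4 : ℝ) ≤ t := by exact_mod_cast h₁
  unfold stefanPerm
  rw [if_neg (by omega)]
  split_ifs with h
  · have ht : (t : ℝ) ≤ k + 1 := by exact_mod_cast h
    rw [dotsMap_of_mem_Icc_four ⟨ht₁, ht⟩]
    push_cast [show t ≤ 2 * k + 3 by omega]
    ring
  · have ht : (k + 2 : ℝ) ≤ t := by exact_mod_cast (by omega : k + 2 ≤ t)
    have ht' : (t : ℝ) ≤ 2 * k - 1 := by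
      rw [le_sub_iff_add_le]; exact_mod_cast (by omega : t + 1 ≤ 2 * k)
    rw [dotsMap_of_mem_Icc_right hK ⟨ht, ht'⟩]
    push_cast [show t ≤ 2 * k + 2 by omega]
    ring

end Dynamics

/-- The two second minimal permutations arising from setting `(1, 2k−1)`. -/
theorem realized_setting_1_2km1 (k : ℕ) (hk : 4 ≤ k) :
    RealizedSM k (fun t =>
      if t = 1 then 2*k+1 else if t = 2 then k+1 else if t = 2*k then 1
      else if t = 2*k+1 then 2 else stefanPerm k t) ∧
    RealizedSM k (fun t =>
      if t = 1 then 2*k else if t = 2 then k+1 else if t = 3 then 2*k+1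
      else if t = 2*k+1 then 1 else stefanPerm k t) := by
  have hK : (4 : ℝ) ≤ k := by exact_mod_cast hk
  constructor
  · refine realizedSM_of_dotsMap hk (Or.inl rfl) ?_ ?_ ?_
    · rintro t ⟨ht₁, ht₂⟩
      simp only [stefanPerm, mem_Icc]
      split_ifs <;> omega
    · rintro s ⟨hs₁, hs₂⟩ t ⟨ht₁, ht₂⟩ h
      simp only [stefanPerm] at h
      split_ifs at h <;> omega
    · rintro t ⟨ht₁, ht₂⟩
      rcases (by omega : t = 1 ∨ t = 2 ∨ t = 3 ∨ (4 ≤ t ∧ t ≤ 2 * k - 1) ∨ t = 2 * k ∨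
        t = 2 * k + 1) with rfl | rfl | rfl | ⟨h, h'⟩ | rfl | rfl
      · rw [dotsMap_of_le_two (by norm_num)]
        push_cast
        ring
      · rw [dotsMap_of_le_two (by norm_num)]
        push_cast
        ring
      · rw [dotsMap_of_mem_Icc_two_three (by norm_num), if_neg (by omega), if_neg (by omega),
          if_neg (by omega), if_neg (by omega), stefanPerm, if_neg (by omega), if_pos (by omega)]
        push_cast [show 3 ≤ 2 * k + 3 by omega]
        ring
      · rw [dotsMap_natCast_eq_stefanPerm hk h h', if_neg (by omega), if_neg (by omega),
          if_neg (by omega), if_neg (by omega)]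
      · rw [dotsMap_of_two_mul_le hK (by push_cast; rfl), if_neg (by omega), if_neg (by omega),
          if_pos rfl]
        push_cast
        ring
      · rw [dotsMap_of_two_mul_le hK (by push_cast; linarith), if_neg (by omega),
          if_neg (by omega), if_neg (by omega), if_pos rfl]
        push_cast
        ring
  · refine realizedSM_of_dotsMap hk (Or.inr rfl) ?_ ?_ ?_
    · rintro t ⟨ht₁, ht₂⟩
      simp only [stefanPerm, mem_Icc]
      split_ifs <;> omega
    · rintro s ⟨hs₁, hs₂⟩ t ⟨ht₁, ht₂⟩ h
      simp only [stefanPerm] at h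
      split_ifs at h <;> omega
    · rintro t ⟨ht₁, ht₂⟩
      rcases (by omega : t = 1 ∨ t = 2 ∨ t = 3 ∨ (4 ≤ t ∧ t ≤ 2 * k - 1) ∨ t = 2 * k ∨
        t = 2 * k + 1) with rfl | rfl | rfl | ⟨h, h'⟩ | rfl | rfl
      · rw [dotsMap_of_le_two (by norm_num)]
        push_cast
        ring
      · rw [dotsMap_of_le_two (by norm_num)]
        push_cast
        ring
      · rw [dotsMap_of_mem_Icc_two_three (by norm_num)]
        push_cast
        ring
      · rw [dotsMap_natCast_eq_stefanPerm hk h h', if_neg (by omega), if_neg (by omega),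
          if_neg (by omega), if_neg (by omega)]
      · rw [dotsMap_of_two_mul_le hK (by push_cast; rfl), if_neg (by omega), if_neg (by omega),
          if_neg (by omega), if_neg (by omega), stefanPerm, if_neg (by omega), if_neg (by omega)]
        push_cast [show 2 * k ≤ 2 * k + 2 by omega]
        ring
      · rw [dotsMap_of_two_mul_le hK (by push_cast; linarith), if_neg (by omega),
          if_neg (by omega), if_neg (by omega), if_pos rfl]
        push_cast
        ring
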